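/- arXiv:1910.12014 — 3 statements merged into one kernel-verified Lean document; each statement's English description precedes it below -/
import Mathlib

section
/- Let X be a topological space, E a real vector space, Y ⊆ E a non-empty convex set, and J : X × Y → ℝ a function which is lower semicontinuous and inf-compact in the first variable (i.e., for each y ∈ Y, all sublevel sets {x ∈ X : J(x,y) ≤ ρ} are compact) and concave in the second variable. Assume that sup_{y∈Y} inf_{x∈X} J(x,y) < inf_{x∈X} sup_{y∈Y} J(x,y). Then there exists ŷ ∈ Y such that the function x ↦ J(x,ŷ) has at least two global minima in X. -/
open Set Filter

noncomputable section

/-- An inf-compact lower semicontinuous function on a nonempty space has a global minimum. -/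
theorem LowerSemicontinuous.exists_forall_le_of_isCompact_sublevel {X : Type*} [TopologicalSpace X]
    [Nonempty X] {f : X → ℝ} (hf : LowerSemicontinuous f)
    (hc : ∀ ρ : ℝ, IsCompact {x : X | f x ≤ ρ}) : ∃ x, ∀ z, f x ≤ f z := by
  obtain ⟨x₀⟩ := ‹Nonempty X›
  obtain ⟨x, hx, hmin⟩ := (hf.lowerSemicontinuousOn _).exists_isMinOn
    (s := {x : X | f x ≤ f x₀}) ⟨x₀, le_refl (f x₀)⟩ (hc _)
  refine ⟨x, fun z => ?_⟩
  by_cases hz : f z ≤ f x₀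
  · exact hmin hz
  · exact le_trans hx (not_le.1 hz).le

/-- If `ymax` maximizes the marginal function `y ↦ min J(·, y)` over a convex set and `J(·, ymax)`
has a unique minimizer `xmin`, then `(xmin, ymax)` is a saddle point of `J`. -/
theorem le_of_isMax_marginal {X : Type*} [TopologicalSpace X]
    {E : Type*} [AddCommGroup E] [Module ℝ E] {K : Set E} {J : X → E → ℝ}
    (hlsc : ∀ y ∈ K, LowerSemicontinuous fun x => J x y)
    (hcpt : ∀ y ∈ K, ∀ ρ : ℝ, IsCompact {x : X | J x y ≤ ρ})
    (hconc : ∀ x : X, ConcaveOn ℝ K (J x))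
    {ymax : E} (hymax : ymax ∈ K) {xmin : X} (hxmin : ∀ x, J xmin ymax ≤ J x ymax)
    (huniq : ∀ x, J x ymax ≤ J xmin ymax → x = xmin)
    (hmax : ∀ y ∈ K, ∃ x, J x y ≤ J xmin ymax) {y : E} (hy : y ∈ K) :
    J xmin y ≤ J xmin ymax := by
  have : Nonempty X := ⟨xmin⟩
  set M := J xmin ymax with hM
  obtain ⟨w, hw⟩ := (hlsc y hy).exists_forall_le_of_isCompact_sublevel (hcpt y hy)
  have key : ∀ t : ℝ, 0 < t → t < 1 →
      ∃ x, J x y ≤ M ∧ (1 - t) * J x ymax ≤ M - t * J w y := by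
    intro t h0 h1
    have hmem : (1 - t) • ymax + t • y ∈ K :=
      (hconc xmin).1 hymax hy (by linarith) h0.le (by ring)
    obtain ⟨x, hx⟩ := hmax _ hmem
    have hc := (hconc x).2 hymax hy (sub_nonneg.2 h1.le) h0.le (by ring)
    simp only [smul_eq_mul] at hc
    have h2 := hxmin x
    refine ⟨x, ?_, ?_⟩
    · have : (1 - t) * M ≤ (1 - t) * J x ymax :=
        mul_le_mul_of_nonneg_left h2 (by linarith)
      have : t * J x y ≤ t * M := by linarith
      exact le_of_mul_le_mul_left this h0
    · have := mul_le_mul_of_nonneg_left (hw x) h0.le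
      linarith
  obtain ⟨x₁, hx₁, -⟩ := key (1 / 2) (by norm_num) (by norm_num)
  obtain ⟨v, hv, hvmin⟩ := ((hlsc ymax hymax).lowerSemicontinuousOn _).exists_isMinOn
    (s := {x : X | J x y ≤ M}) ⟨x₁, hx₁⟩ (hcpt y hy M)
  have hbound : ∀ t ∈ Ioo (0 : ℝ) 1, (1 - t) * J v ymax ≤ M - t * J w y := by
    intro t ht
    obtain ⟨x, hx, hx'⟩ := key t ht.1 ht.2
    have h3 : J v ymax ≤ J x ymax := hvmin hx
    exact (mul_le_mul_of_nonneg_left h3 (by linarith [ht.2])).trans hx'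
  have hvM : J v ymax ≤ M := by
    have hcl : IsClosed {t : ℝ | (1 - t) * J v ymax ≤ M - t * J w y} :=
      isClosed_le (by fun_prop) (by fun_prop)
    have h0 : (0 : ℝ) ∈ closure (Ioo (0 : ℝ) 1) := by
      rw [closure_Ioo (by norm_num)]; norm_num
    simpa using hcl.closure_subset_iff.2 hbound h0
  exact huniq v hvM ▸ hv

/-- A minimax inequality for functions that are moreover continuous in the second variable on a
compact convex set of parameters. -/
theorem exists_forall_le_of_isCompact {X : Type*} [TopologicalSpace X] [Nonempty X]
    {V : Type*} [AddCommGroup V] [Module ℝ V] [TopologicalSpace V] {K : Set V} {J : X → V → ℝ}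
    (hK : IsCompact K) (hKne : K.Nonempty)
    (hlsc : ∀ y ∈ K, LowerSemicontinuous fun x => J x y)
    (hcpt : ∀ y ∈ K, ∀ ρ : ℝ, IsCompact {x : X | J x y ≤ ρ})
    (hconc : ∀ x : X, ConcaveOn ℝ K (J x)) (hcont : ∀ x : X, ContinuousOn (J x) K)
    (huniq : ∀ y ∈ K, ∀ x₁ x₂, (∀ x, J x₁ y ≤ J x y) → (∀ x, J x₂ y ≤ J x y) → x₁ = x₂)
    {c : ℝ} (hc : ∀ y ∈ K, ∃ x, J x y ≤ c) : ∃ x, ∀ y ∈ K, J x y ≤ c := by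
  have hex : ∀ y : V, ∃ x, y ∈ K → ∀ z, J x y ≤ J z y := by
    intro y
    by_cases hy : y ∈ K
    · obtain ⟨x, hx⟩ := (hlsc y hy).exists_forall_le_of_isCompact_sublevel (hcpt y hy)
      exact ⟨x, fun _ => hx⟩
    · exact ⟨Classical.arbitrary X, fun h => absurd h hy⟩
  choose ξ hξ using hex
  have husc : UpperSemicontinuousOn (fun y => J (ξ y) y) K := by
    intro y hy a ha
    filter_upwards [(hcont (ξ y) y hy).eventually_lt_const ha, self_mem_nhdsWithin] with z hz hzK
    exact (hξ z hzK _).trans_lt hz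
  obtain ⟨ymax, hymax, hmax⟩ := husc.exists_isMaxOn hKne hK
  refine ⟨ξ ymax, fun y hy => ?_⟩
  obtain ⟨x, hx⟩ := hc ymax hymax
  refine (le_of_isMax_marginal hlsc hcpt hconc hymax (hξ ymax hymax) (fun x hx => ?_)
    (fun z hz => ⟨ξ z, hmax hz⟩) hy).trans ((hξ ymax hymax x).trans hx)
  exact huniq ymax hymax _ _ (fun z => hx.trans (hξ ymax hymax z)) (hξ ymax hymax)

/-- Sublevel sets of `J(·, y)`, for finitely many parameters `y`, have a common point as soon as
the level exceeds every minimum and minimizers are unique. -/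
theorem exists_forall_mem_finset_le {X : Type*} [TopologicalSpace X] [Nonempty X]
    {E : Type*} [AddCommGroup E] [Module ℝ E] {Y : Set E} {J : X → E → ℝ}
    (hlsc : ∀ y ∈ Y, LowerSemicontinuous fun x => J x y)
    (hcpt : ∀ y ∈ Y, ∀ ρ : ℝ, IsCompact {x : X | J x y ≤ ρ})
    (hconc : ∀ x : X, ConcaveOn ℝ Y (J x))
    (huniq : ∀ y ∈ Y, ∀ x₁ x₂, (∀ x, J x₁ y ≤ J x y) → (∀ x, J x₂ y ≤ J x y) → x₁ = x₂)
    {c r : ℝ} (hcr : c < r) (hc : ∀ y ∈ Y, ∃ x, J x y ≤ c)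
    (t : Finset E) (ht : ∀ y ∈ t, y ∈ Y) : ∃ x, ∀ y ∈ t, J x y ≤ r := by
  classical
  rcases t.eq_empty_or_nonempty with rfl | ⟨y₀, hy₀⟩
  · exact ⟨Classical.arbitrary X, by simp⟩
  have hYconv : Convex ℝ Y := (hconc (Classical.arbitrary X)).1
  let L : (t → ℝ) →ₗ[ℝ] E := ∑ i : t, (LinearMap.proj i).smulRight ((i : E) - y₀)
  have hL : ∀ μ, L μ = ∑ i : t, μ i • ((i : E) - y₀) := by
    intro μ; simp [L]
  let φ : (t → ℝ) →ᵃ[ℝ] E := L.toAffineMap + AffineMap.const ℝ _ y₀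
  have hφ : ∀ μ, φ μ = L μ + y₀ := fun μ => rfl
  have hφ_single : ∀ i : t, φ (Pi.single i 1) = i := by
    intro i
    simp [hφ, hL, Pi.single_apply]
  let U : Set (t → ℝ) := {μ | (∀ i, 0 < μ i) ∧ ∑ i, μ i < 1}
  have hUopen : IsOpen U := by
    have hU : U = (⋂ i, {μ | 0 < μ i}) ∩ {μ | ∑ i, μ i < 1} := by ext; simp [U]
    rw [hU]
    exact (isOpen_iInter_of_finite fun i => isOpen_lt continuous_const (continuous_apply i)).inter
      (isOpen_lt (continuous_finsetSum _ fun i _ => continuous_apply i) continuous_const)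
  have hUconv : Convex ℝ U := by
    intro μ hμ ν hν a b ha hb hab
    refine ⟨fun i => ?_, ?_⟩
    · have h1 := hμ.1 i
      have h2 := hν.1 i
      simp only [Pi.add_apply, Pi.smul_apply, smul_eq_mul]
      rcases ha.eq_or_lt with rfl | ha
      · have : b = 1 := by linarith
        subst this; simpa using h2
      · have := mul_pos ha h1
        have := mul_nonneg hb h2.le
        linarith
    · have h1 := hμ.2
      have h2 := hν.2
      simp only [Pi.add_apply, Pi.smul_apply, smul_eq_mul, Finset.sum_add_distrib,
        ← Finset.mul_sum]
      rcases ha.eq_or_lt with rfl | ha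
      · have : b = 1 := by linarith
        subst this; simpa using h2
      · have := mul_lt_mul_of_pos_left h1 ha
        have := mul_le_mul_of_nonneg_left h2.le hb
        linarith
  have hφU : ∀ μ ∈ U, φ μ ∈ Y := by
    intro μ hμ
    have h1 : φ μ = (1 - ∑ i, μ i) • y₀ + ∑ i : t, μ i • (i : E) := by
      rw [hφ, hL]
      simp only [smul_sub, Finset.sum_sub_distrib, ← Finset.sum_smul, sub_smul, one_smul]
      abel
    have h2 := hYconv.sum_mem (t := (Finset.univ : Finset (Option t)))
      (w := fun o => o.elim (1 - ∑ i, μ i) μ) (z := fun o => o.elim y₀ (fun i => (i : E)))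
      (by rintro (_ | i) -
          · simpa using hμ.2.le
          · exact (hμ.1 i).le)
      (by simp [Fintype.sum_option])
      (by rintro (_ | i) -
          · exact ht _ hy₀
          · exact ht _ i.2)
    rw [h1]
    simpa [Fintype.sum_option] using h2
  have hconcU : ∀ x, ConcaveOn ℝ U (fun μ => J x (φ μ)) := fun x =>
    ((hconc x).comp_affineMap φ).subset hφU hUconv
  obtain ⟨N, hN0, hN⟩ : ∃ N : ℝ, 0 < N ∧ (Fintype.card t : ℝ) < N :=
    ⟨Fintype.card t + 1, by positivity, by linarith⟩
  let b : t → ℝ := fun _ => N⁻¹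
  have hbsum : ∑ i, b i < 1 := by
    simp only [b, Finset.sum_const, Finset.card_univ, nsmul_eq_mul]
    rw [← div_eq_mul_inv, div_lt_one hN0]
    exact hN
  have hbU : b ∈ U := ⟨fun i => inv_pos.2 hN0, hbsum⟩
  obtain ⟨w, hw⟩ := (hlsc _ (hφU b hbU)).exists_forall_le_of_isCompact_sublevel
    (hcpt _ (hφU b hbU))
  obtain ⟨δ, ⟨hδ0, hδ1⟩, hδ⟩ :
      ∃ δ : ℝ, δ ∈ Ioo (0 : ℝ) 1 ∧ c - δ * J w (φ b) < (1 - δ) * r := by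
    have hcont : Continuous fun δ : ℝ => (1 - δ) * r - (c - δ * J w (φ b)) := by fun_prop
    have hpos : ∀ᶠ δ : ℝ in nhdsWithin 0 (Ioi 0), 0 < (1 - δ) * r - (c - δ * J w (φ b)) :=
      (hcont.tendsto 0).eventually_const_lt (by simpa using hcr) |>.filter_mono
        nhdsWithin_le_nhds
    obtain ⟨δ, h1, h2⟩ := (hpos.and (Ioo_mem_nhdsGT (zero_lt_one' ℝ))).exists
    exact ⟨δ, h2, by linarith⟩
  let p : t → t → ℝ := fun i => (1 - δ) • Pi.single i 1 + δ • b
  have hpU : ∀ i, p i ∈ U := by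
    intro i
    refine ⟨fun j => ?_, ?_⟩
    · have h1 : (0 : ℝ) ≤ (Pi.single i 1 : t → ℝ) j := by
        rw [Pi.single_apply]; split_ifs <;> norm_num
      have h2 : 0 < b j := hbU.1 j
      simp only [p, Pi.add_apply, Pi.smul_apply, smul_eq_mul]
      have := mul_nonneg (sub_nonneg.2 hδ1.le) h1
      have := mul_pos hδ0 h2
      linarith
    · have h1 : ∑ j, (Pi.single i 1 : t → ℝ) j = 1 := by simp [Pi.single_apply]
      simp only [p, Pi.add_apply, Pi.smul_apply, smul_eq_mul, Finset.sum_add_distrib,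
        ← Finset.mul_sum, h1]
      have := mul_lt_mul_of_pos_left hbsum hδ0
      linarith
  have hφp : ∀ i, φ (p i) = (1 - δ) • (i : E) + δ • φ b := by
    intro i
    rw [← hφ_single i]
    simp only [p, hφ, map_add, map_smul]
    module
  have hKU : convexHull ℝ (range p) ⊆ U :=
    convexHull_min (range_subset_iff.2 hpU) hUconv
  obtain ⟨x, hx⟩ := exists_forall_le_of_isCompact (J := fun x μ => J x (φ μ)) (c := c)
    ((finite_range p).isCompact_convexHull (𝕜 := ℝ))
    ⟨p ⟨y₀, hy₀⟩, subset_convexHull ℝ _ (mem_range_self _)⟩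
    (fun μ hμ => hlsc _ (hφU μ (hKU hμ))) (fun μ hμ => hcpt _ (hφU μ (hKU hμ)))
    (fun x => (hconcU x).subset hKU (convex_convexHull ℝ _))
    (fun x => ((hconcU x).continuousOn hUopen).mono hKU)
    (fun μ hμ => huniq _ (hφU μ (hKU hμ))) (fun μ hμ => hc _ (hφU μ (hKU hμ)))
  refine ⟨x, fun y hy => ?_⟩
  have h1 := hx (p ⟨y, hy⟩) (subset_convexHull ℝ _ (mem_range_self _))
  have h2 := (hconc x).2 (ht y hy) (hφU b hbU) (sub_nonneg.2 hδ1.le) hδ0.le (by ring)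
  simp only [hφp, smul_eq_mul] at h1 h2
  have h3 := mul_le_mul_of_nonneg_left (hw x) hδ0.le
  exact le_of_mul_le_mul_left (by linarith : (1 - δ) * J x y ≤ (1 - δ) * r) (by linarith)

/-- **Theorem 2.A** (Ricceri's minimax theorem). Let `X` be a topological space, `E` a real
vector space, `Y ⊆ E` nonempty and convex, and `J : X × Y → ℝ` lower semicontinuous and
inf-compact in the first variable and concave in the second. If
`sup_{y∈Y} inf_{x∈X} J(x,y) < inf_{x∈X} sup_{y∈Y} J(x,y)`, then there is `ŷ ∈ Y` such that
`J(·,ŷ)` has at least two global minima. -/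
theorem minimax_two_global_minima
    (X : Type*) [TopologicalSpace X]
    (E : Type*) [AddCommGroup E] [Module ℝ E]
    (Y : Set E) (hYne : Y.Nonempty) (hYconv : Convex ℝ Y)
    (J : X → E → ℝ)
    (hlsc : ∀ y ∈ Y, LowerSemicontinuous fun x => J x y)
    (hinfcpt : ∀ y ∈ Y, ∀ ρ : ℝ, IsCompact {x : X | J x y ≤ ρ})
    (hconc : ∀ x : X, ConcaveOn ℝ Y (J x))
    (hminimax : (⨆ y : Y, ⨅ x : X, ((J x y : ℝ) : EReal)) <
                 ⨅ x : X, ⨆ y : Y, ((J x y : ℝ) : EReal)) :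
    ∃ yhat ∈ Y, ∃ x₁ x₂ : X, x₁ ≠ x₂ ∧
      (∀ x : X, J x₁ yhat ≤ J x yhat) ∧ (∀ x : X, J x₂ yhat ≤ J x yhat) := by
  by_contra! hcon
  have hX : Nonempty X := by
    by_contra hX
    have hX' : IsEmpty X := not_nonempty_iff.1 hX
    have hY' : Nonempty Y := hYne.to_subtype
    simp only [iInf_of_empty, ciSup_const, lt_self_iff_false] at hminimax
  have huniq : ∀ y ∈ Y, ∀ x₁ x₂, (∀ x, J x₁ y ≤ J x y) → (∀ x, J x₂ y ≤ J x y) →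
      x₁ = x₂ := by
    intro y hy x₁ x₂ h1 h2
    by_contra hne
    obtain ⟨x, hx⟩ := hcon y hy x₁ x₂ hne h1
    exact absurd (h2 x) (not_le.2 hx)
  obtain ⟨r, hr, hr'⟩ := EReal.lt_iff_exists_real_btwn.1 hminimax
  obtain ⟨c, hc, hc'⟩ := EReal.lt_iff_exists_real_btwn.1 hr
  have hlow : ∀ y ∈ Y, ∃ x, J x y ≤ c := by
    intro y hy
    have h1 : (⨅ x : X, ((J x y : ℝ) : EReal)) < c :=
      (le_iSup (fun y : Y => ⨅ x : X, ((J x y : ℝ) : EReal)) ⟨y, hy⟩).trans_lt hc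
    obtain ⟨x, hx⟩ := iInf_lt_iff.1 h1
    exact ⟨x, (EReal.coe_lt_coe_iff.1 hx).le⟩
  have hfin := fun t ht => exists_forall_mem_finset_le hlsc hinfcpt hconc huniq
    (EReal.coe_lt_coe_iff.1 hc') hlow t ht
  obtain ⟨y₀, hy₀⟩ := hYne
  classical
  obtain ⟨x, -, hx⟩ := (hinfcpt y₀ hy₀ r).inter_iInter_nonempty
    (fun y : Y => {x | J x y ≤ r}) (fun y => (hlsc y y.2).isClosed_preimage r) (by
      intro u
      obtain ⟨x, hx⟩ := hfin (insert y₀ (u.image Subtype.val)) (by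
        simp only [Finset.mem_insert, Finset.mem_image]
        rintro y (rfl | ⟨z, -, rfl⟩)
        exacts [hy₀, z.2])
      refine ⟨x, hx y₀ (by simp), mem_iInter₂.2 fun y hy => hx y ?_⟩
      exact Finset.mem_insert_of_mem (Finset.mem_image_of_mem _ hy))
  rw [mem_iInter] at hx
  refine absurd (hr'.trans_le ((iInf_le _ x).trans (iSup_le fun y => ?_))) (lt_irrefl (r : EReal))
  exact EReal.coe_le_coe_iff.2 (hx y)
end
end

section
/- Let X, Y be two non-empty sets and f : X → ℝ, g : X × Y → ℝ two given functions. Assume that there are two sets A, B ⊆ X such that: (a) sup_A f < inf_B f; (b) sup_{y∈Y} inf_{x∈A} g(x,y) ≤ 0; (c) inf_{x∈B} sup_{y∈Y} g(x,y) ≥ 0; (d) inf_{x∈X∖B} sup_{y∈Y} g(x,y) = +∞. Then sup_{y∈Y} inf_{x∈X} (f(x) + g(x,y)) < inf_{x∈X} sup_{y∈Y} (f(x) + g(x,y)). -/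
open Set Filter

noncomputable section

/-- Translating a real family by `t` translates real lower bounds of its supremum by `t`. -/
theorem add_coe_le_iSup_add {ι : Sort*} (u : ι → ℝ) (t a : ℝ)
    (h : (a : EReal) ≤ ⨆ i, (u i : EReal)) :
    ((t + a : ℝ) : EReal) ≤ ⨆ i, ((t + u i : ℝ) : EReal) := by
  by_contra! hlt
  obtain ⟨c, hc, hca⟩ := EReal.lt_iff_exists_real_btwn.1 hlt
  have hca : c < t + a := EReal.coe_lt_coe_iff.1 hca
  have hle : (⨆ i, (u i : EReal)) ≤ ((c - t : ℝ) : EReal) := by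
    refine iSup_le fun i => EReal.coe_le_coe_iff.2 ?_
    have hi : t + u i < c := EReal.coe_lt_coe_iff.1 ((le_iSup _ i).trans_lt hc)
    linarith
  have := EReal.coe_le_coe_iff.1 (h.trans hle)
  linarith

/-- The infimum of a sum is at most the supremum of one summand when the infimum of the other
summand is nonpositive. -/
theorem iInf_add_coe_le_iSup {ι : Sort*} (u v : ι → ℝ)
    (hv : (⨅ i, (v i : EReal)) ≤ 0) :
    (⨅ i, ((u i + v i : ℝ) : EReal)) ≤ ⨆ i, (u i : EReal) := by
  by_contra! hlt
  obtain ⟨d, hd, hdi⟩ := EReal.lt_iff_exists_real_btwn.1 hlt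
  obtain ⟨c, hdc, hci⟩ := EReal.lt_iff_exists_real_btwn.1 hdi
  have hdc : d < c := EReal.coe_lt_coe_iff.1 hdc
  have hpos : (0 : EReal) < ((c - d : ℝ) : EReal) := EReal.coe_pos.2 (sub_pos.2 hdc)
  obtain ⟨i, hi⟩ := iInf_lt_iff.1 (hv.trans_lt hpos)
  have h1 : v i < c - d := EReal.coe_lt_coe_iff.1 hi
  have h2 : u i < d := EReal.coe_lt_coe_iff.1 ((le_iSup _ i).trans_lt hd)
  have h3 : c < u i + v i := EReal.coe_lt_coe_iff.1 (hci.trans_le (iInf_le _ i))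
  linarith

/-- **Proposition 2.A.** Let `X, Y` be nonempty sets, `f : X → ℝ`, `g : X × Y → ℝ`, and
`A, B ⊆ X` with: (a) `sup_A f < inf_B f`; (b) `sup_{y∈Y} inf_{x∈A} g(x,y) ≤ 0`;
(c) `inf_{x∈B} sup_{y∈Y} g(x,y) ≥ 0`; (d) `inf_{x∈X∖B} sup_{y∈Y} g(x,y) = +∞`.
Then `sup_{y∈Y} inf_{x∈X} (f(x)+g(x,y)) < inf_{x∈X} sup_{y∈Y} (f(x)+g(x,y))`. -/
theorem strict_minimax_of_decomposition
    (X Y : Type*) [Nonempty X] [Nonempty Y]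
    (f : X → ℝ) (g : X → Y → ℝ) (A B : Set X)
    (ha : (⨆ x : A, ((f x : ℝ) : EReal)) < ⨅ x : B, ((f x : ℝ) : EReal))
    (hb : (⨆ y : Y, ⨅ x : A, ((g x y : ℝ) : EReal)) ≤ 0)
    (hc : 0 ≤ ⨅ x : B, ⨆ y : Y, ((g x y : ℝ) : EReal))
    (hd : (⨅ x : ↥Bᶜ, ⨆ y : Y, ((g x.1 y : ℝ) : EReal)) = ⊤) :
    (⨆ y : Y, ⨅ x : X, ((f x + g x y : ℝ) : EReal)) <
      ⨅ x : X, ⨆ y : Y, ((f x + g x y : ℝ) : EReal) := by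
  have hlower : (⨆ y : Y, ⨅ x : X, ((f x + g x y : ℝ) : EReal)) ≤
      ⨆ x : A, ((f x : ℝ) : EReal) :=
    iSup_le fun y => (le_iInf fun x : A => iInf_le _ x.1).trans
      (iInf_add_coe_le_iSup (fun x : A => f x) (fun x : A => g x y) ((le_iSup _ y).trans hb))
  refine hlower.trans_lt (ha.trans_le (le_iInf fun x => ?_))
  by_cases hx : x ∈ B
  · refine (iInf_le _ (⟨x, hx⟩ : B)).trans ?_
    simpa using add_coe_le_iSup_add (g x) (f x) 0 (hc.trans (iInf_le _ (⟨x, hx⟩ : B)))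
  · have hg : (⨆ y : Y, ((g x y : ℝ) : EReal)) = ⊤ := iInf_eq_top.1 hd ⟨x, hx⟩
    refine le_top.trans_eq (EReal.eq_top_iff_forall_lt _ |>.2 fun r => ?_).symm
    refine (EReal.coe_lt_coe_iff.2 (lt_add_one r)).trans_le ?_
    simpa using add_coe_le_iSup_add (g x) (f x) (r + 1 - f x) (hg ▸ le_top)
end
end

section
/- Let F : ℝⁿ → ℝ be continuous and let G : ℝⁿ → ℝ be continuous with lim_{|x|→+∞} G(x) = +∞. Suppose x₀ ∈ ℝⁿ is the unique global minimum of G and a strict local, not global, minimum of F. Then there exist x₁ ∈ ℝⁿ and r > G(x₀) such that G(x₁) > r, F(x₁) < F(x₀), and F(x₀) < inf_{x∈G⁻¹(r)} F(x). -/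
open Set Metric

noncomputable section

/-- `ℝⁿ` as a Euclidean space. -/
abbrev En (n : ℕ) := EuclideanSpace ℝ (Fin n)

/-- Key step in the proof of Corollary 2.2: if `G` is continuous, coercive, with unique
global minimum `x₀`, and `x₀` is a strict local, not global, minimum of the continuous
function `F`, then there are `x₁` and `r > G(x₀)` with `G(x₁) > r`, `F(x₁) < F(x₀)` and
`F(x₀) < inf_{G⁻¹(r)} F`. -/
theorem exists_level_and_point
    (n : ℕ) (hn : 1 ≤ n) (F G : En n → ℝ)
    (hFc : Continuous F) (hGc : Continuous G)
    (hGcoer : ∀ M : ℝ, ∃ R : ℝ, ∀ x : En n, R < ‖x‖ → M < G x)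
    (x₀ : En n) (hGmin : ∀ x : En n, x ≠ x₀ → G x₀ < G x)
    (hFlocmin : ∃ ρ : ℝ, 0 < ρ ∧ ∀ x : En n, x ≠ x₀ → ‖x - x₀‖ < ρ → F x₀ < F x)
    (hFnotglob : ∃ x₁ : En n, F x₁ < F x₀) :
    ∃ x₁ : En n, ∃ r : ℝ, G x₀ < r ∧ r < G x₁ ∧ F x₁ < F x₀ ∧
      F x₀ < ⨅ x : {y : En n // G y = r}, F x.1 := by
  obtain ⟨ρ, hρ, hF⟩ := hFlocmin
  obtain ⟨x₁, hx₁⟩ := hFnotglob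
  have hne : x₁ ≠ x₀ := by
    rintro rfl
    exact lt_irrefl _ hx₁
  have hfar : ρ ≤ ‖x₁ - x₀‖ := by
    by_contra! h
    exact lt_asymm hx₁ (hF x₁ hne h)
  -- The minimum of `G` outside the ball of radius `ρ` is attained, and exceeds `G x₀`.
  have hcl : IsClosed {x : En n | ρ ≤ ‖x - x₀‖} :=
    isClosed_le continuous_const (by fun_prop)
  have hev : ∀ᶠ x in Filter.cocompact (En n) ⊓ Filter.principal {x : En n | ρ ≤ ‖x - x₀‖},
      G x₁ ≤ G x := by
    obtain ⟨R, hR⟩ := hGcoer (G x₁)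
    refine Filter.Eventually.filter_mono inf_le_left ?_
    filter_upwards [(tendsto_norm_cocompact_atTop (E := En n)).eventually_gt_atTop R] with x hx
    exact (hR x hx).le
  obtain ⟨y, hy, hymin⟩ := hGc.continuousOn.exists_isMinOn' hcl hfar hev
  have hyne : y ≠ x₀ := by
    rintro rfl
    simp only [mem_ofPred_eq, sub_self, norm_zero] at hy
    linarith
  have hmin : ∀ x, ρ ≤ ‖x - x₀‖ → G y ≤ G x := fun x hx => hymin hx
  obtain ⟨r, hr₀, hry⟩ := exists_between (hGmin y hyne)
  refine ⟨x₁, r, hr₀, hry.trans_le (hmin x₁ hfar), hx₁, ?_⟩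
  have hcompact : IsCompact {z : En n | G z = r} := by
    refine (isCompact_closedBall x₀ ρ).of_isClosed_subset
      (isClosed_eq hGc continuous_const) fun z (hz : G z = r) => ?_
    rw [mem_closedBall, dist_eq_norm]
    by_contra! h
    linarith [hmin z h.le]
  have hnonempty : {z : En n | G z = r}.Nonempty :=
    mem_range_of_exists_le_of_exists_ge hGc ⟨x₀, hr₀.le⟩ ⟨y, hry.le⟩
  obtain ⟨z, hz, hzmin⟩ := hcompact.exists_isMinOn hnonempty hFc.continuousOn
  have hz' : G z = r := hz
  have hFz : F x₀ < F z := by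
    refine hF z ?_ ?_
    · rintro rfl
      exact hr₀.ne hz'
    · by_contra! h
      linarith [hmin z h]
  have : Nonempty {y : En n // G y = r} := ⟨⟨z, hz⟩⟩
  exact hFz.trans_le (le_ciInf fun x => hzmin x.2)
end
end
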